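/- (Optimality is equivalent to boundary membership.) Let n m : ℕ, let T ⊆ ℝ be nonempty and compact, let Γ : ℝ → Matrix (Fin n) (Fin m) ℝ be continuous, and assume 0 lies in the interior of S*(1,T) in ℝⁿ. Let c > 0 and ω ∈ ℝⁿ. Then c is the minimum cost to reach ω — i.e., ω ∈ S*(c,T) and ω ∉ S*(c',T) for every 0 ≤ c' < c — if and only if ω lies in the topological boundary (frontier) of S*(c,T). -/

import Mathlib

open Matrix
open scoped RealInnerProductSpace

/-- Single-impulse reachable set `S(c,T)`: states reachable by one impulse of cost at most `c`
applied at some time in `T`. -/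
noncomputable def singleReach (n m : ℕ) (Γ : ℝ → Matrix (Fin n) (Fin m) ℝ) (c : ℝ) (T : Set ℝ) :
    Set (EuclideanSpace ℝ (Fin n)) :=
  {y | ∃ t ∈ T, ∃ u : EuclideanSpace ℝ (Fin m), ‖u‖ ≤ c ∧ y = (Γ t).mulVec u}

/-- Multi-impulse reachable set `S*(c,T)`: states reachable by finitely many impulses at times in
`T` of total cost at most `c`. -/
noncomputable def multiReach (n m : ℕ) (Γ : ℝ → Matrix (Fin n) (Fin m) ℝ) (c : ℝ) (T : Set ℝ) :
    Set (EuclideanSpace ℝ (Fin n)) :=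
  {y | ∃ k : ℕ, ∃ t : Fin k → ℝ, ∃ u : Fin k → EuclideanSpace ℝ (Fin m),
      (∀ j, t j ∈ T) ∧ (∑ j, ‖u j‖) ≤ c ∧ y = ∑ j, (Γ (t j)).mulVec (u j)}

section

open scoped Pointwise

theorem isCompact_convexHull_of_finiteDimensional {E : Type*} [NormedAddCommGroup E]
    [NormedSpace ℝ E] [FiniteDimensional ℝ E] {s : Set E} (hs : IsCompact s) :
    IsCompact (convexHull ℝ s) := by
  have h : convexHull ℝ s = ⋃ k ∈ Finset.range (Module.finrank ℝ E + 2),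
      (fun p : (Fin k → ℝ) × (Fin k → E) => ∑ i, p.1 i • p.2 i) ''
        (stdSimplex ℝ (Fin k) ×ˢ Set.univ.pi fun _ => s) := by
    apply Set.Subset.antisymm
    · intro x hx
      obtain ⟨ι, _, z, w, hz, hind, hw, hw1, hx⟩ := eq_pos_convex_span_of_mem_convexHull hx
      have hcard : Fintype.card ι ≤ Module.finrank ℝ E + 1 :=
        hind.card_le_finrank_succ.trans (Nat.succ_le_succ (Submodule.finrank_le _))
      let e := (Fintype.equivFin ι).symm
      simp only [Set.mem_iUnion, Finset.mem_range]
      refine ⟨Fintype.card ι, by lia, (w ∘ e, z ∘ e),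
        ⟨⟨fun i => (hw _).le, ?_⟩, fun i _ => hz ⟨e i, rfl⟩⟩, ?_⟩
      · exact (e.sum_comp w).trans hw1
      · exact (e.sum_comp fun i => w i • z i).trans hx
    · simp only [Set.iUnion_subset_iff]
      rintro k - _ ⟨⟨w, z⟩, ⟨⟨hw, hw1⟩, hz⟩, rfl⟩
      exact (convex_convexHull ℝ s).sum_mem (fun i _ => hw i) hw1
        fun i _ => subset_convexHull ℝ s (hz i trivial)
  rw [h]
  refine Finset.isCompact_biUnion _ fun k _ => ?_
  refine ((isCompact_stdSimplex ℝ (Fin k)).prod (isCompact_univ_pi fun _ => hs)).image ?_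
  fun_prop

theorem smul_convexHull_singleReach_mono (n m : ℕ) (T : Set ℝ)
    (hT : T.Nonempty) (Γ : ℝ → Matrix (Fin n) (Fin m) ℝ) {a b : ℝ} (ha : 0 ≤ a) (hab : a ≤ b) :
    a • convexHull ℝ (singleReach n m Γ 1 T) ⊆ b • convexHull ℝ (singleReach n m Γ 1 T) := by
  have h0 : (0 : EuclideanSpace ℝ (Fin n)) ∈ convexHull ℝ (singleReach n m Γ 1 T) := by
    obtain ⟨t, ht⟩ := hT
    exact subset_convexHull ℝ _ ⟨t, ht, 0, by simp, by simp⟩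
  have h := (convex_convexHull ℝ (singleReach n m Γ 1 T)).add_smul ha (sub_nonneg.2 hab)
  rw [add_sub_cancel] at h
  rw [h]
  exact Set.subset_add_left _ ⟨0, h0, smul_zero _⟩

theorem isCompact_singleReach (n m : ℕ) {T : Set ℝ} (hT : IsCompact T)
    {Γ : ℝ → Matrix (Fin n) (Fin m) ℝ} (hΓ : Continuous Γ) (c : ℝ) :
    IsCompact (singleReach n m Γ c T) := by
  have hf : Continuous fun p : ℝ × EuclideanSpace ℝ (Fin m) =>
      WithLp.toLp 2 ((Γ p.1).mulVec p.2.ofLp) := by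
    refine (PiLp.continuous_toLp 2 _).comp ?_
    exact (hΓ.comp continuous_fst).matrix_mulVec ((PiLp.continuous_ofLp 2 _).comp continuous_snd)
  convert (hT.prod (isCompact_closedBall (0 : EuclideanSpace ℝ (Fin m)) c)).image hf using 1
  ext y
  constructor
  · rintro ⟨t, ht, u, hu, hy⟩
    exact ⟨(t, u), ⟨ht, by simpa using hu⟩, by simp [← hy]⟩
  · rintro ⟨⟨t, u⟩, ⟨ht, hu⟩, rfl⟩
    exact ⟨t, ht, u, by simpa using hu, rfl⟩

theorem smul_mem_multiReach {n m : ℕ} {T : Set ℝ} {Γ : ℝ → Matrix (Fin n) (Fin m) ℝ}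
    {c r : ℝ} (hr : 0 ≤ r) {y : EuclideanSpace ℝ (Fin n)} (hy : y ∈ multiReach n m Γ c T) :
    r • y ∈ multiReach n m Γ (r * c) T := by
  obtain ⟨k, t, u, ht, hu, hy⟩ := hy
  refine ⟨k, t, fun j => r • u j, ht, ?_, ?_⟩
  · simp only [norm_smul, Real.norm_of_nonneg hr, ← Finset.mul_sum]
    gcongr
  · simp [hy, Finset.smul_sum, Matrix.mulVec_smul]

theorem add_mem_multiReach {n m : ℕ} {T : Set ℝ} {Γ : ℝ → Matrix (Fin n) (Fin m) ℝ}
    {a b : ℝ} {x y : EuclideanSpace ℝ (Fin n)} (hx : x ∈ multiReach n m Γ a T)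
    (hy : y ∈ multiReach n m Γ b T) : x + y ∈ multiReach n m Γ (a + b) T := by
  obtain ⟨k, t, u, ht, hu, hx⟩ := hx
  obtain ⟨l, s, v, hs, hv, hy⟩ := hy
  refine ⟨k + l, Fin.append t s, Fin.append u v, ?_, ?_, ?_⟩
  · exact fun j => Fin.addCases (by simpa using ht) (by simpa using hs) j
  · simpa [Fin.sum_univ_add] using add_le_add hu hv
  · simp [Fin.sum_univ_add, hx, hy]

theorem convex_multiReach (n m : ℕ) (T : Set ℝ) (Γ : ℝ → Matrix (Fin n) (Fin m) ℝ) (c : ℝ) :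
    Convex ℝ (multiReach n m Γ c T) := by
  intro x hx y hy a b ha hb hab
  have h := add_mem_multiReach (smul_mem_multiReach ha hx) (smul_mem_multiReach hb hy)
  rwa [← add_mul, hab, one_mul] at h

theorem toLp_mulVec_mem_smul_convexHull {n m : ℕ} {T : Set ℝ}
    {Γ : ℝ → Matrix (Fin n) (Fin m) ℝ} {t : ℝ} (ht : t ∈ T) (u : EuclideanSpace ℝ (Fin m)) :
    WithLp.toLp 2 ((Γ t).mulVec u.ofLp) ∈ ‖u‖ • convexHull ℝ (singleReach n m Γ 1 T) := by
  refine ⟨WithLp.toLp 2 ((Γ t).mulVec (‖u‖⁻¹ • u).ofLp),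
    subset_convexHull ℝ _ ⟨t, ht, ‖u‖⁻¹ • u, ?_, rfl⟩, ?_⟩
  · rw [norm_smul, norm_inv, norm_norm]
    exact inv_mul_le_one
  · rcases eq_or_ne u 0 with rfl | hu
    · simp
    · simp [← WithLp.toLp_smul, Matrix.mulVec_smul, smul_smul, norm_ne_zero_iff.2 hu]

theorem multiReach_eq_smul_convexHull (n m : ℕ) {T : Set ℝ} (hT : T.Nonempty)
    (Γ : ℝ → Matrix (Fin n) (Fin m) ℝ) {c : ℝ} (hc : 0 ≤ c) :
    multiReach n m Γ c T = c • convexHull ℝ (singleReach n m Γ 1 T) := by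
  apply Set.Subset.antisymm
  · rintro y ⟨k, t, u, ht, hu, hy⟩
    have hsum : ∀ s : Finset (Fin k), ∑ j ∈ s, WithLp.toLp 2 ((Γ (t j)).mulVec (u j).ofLp) ∈
        (∑ j ∈ s, ‖u j‖) • convexHull ℝ (singleReach n m Γ 1 T) := by
      intro s
      induction s using Finset.induction_on with
      | empty =>
        obtain ⟨t₀, ht₀⟩ := hT
        simpa using toLp_mulVec_mem_smul_convexHull (Γ := Γ) ht₀ 0
      | insert j s hj ih =>
        rw [Finset.sum_insert hj, Finset.sum_insert hj, (convex_convexHull ℝ _).add_smul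
          (norm_nonneg _) (Finset.sum_nonneg fun _ _ => norm_nonneg _)]
        exact Set.add_mem_add (toLp_mulVec_mem_smul_convexHull (ht j) (u j)) ih
    have hy' : y = ∑ j, WithLp.toLp 2 ((Γ (t j)).mulVec (u j).ofLp) := by
      rw [← WithLp.toLp_sum, ← hy]
    rw [hy']
    exact smul_convexHull_singleReach_mono n m T hT Γ
      (Finset.sum_nonneg fun _ _ => norm_nonneg _) hu (hsum Finset.univ)
  · rintro _ ⟨y, hy, rfl⟩
    have hy1 : y ∈ multiReach n m Γ 1 T := by
      refine convexHull_min ?_ (convex_multiReach n m T Γ 1) hy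
      rintro z ⟨t, ht, u, hu, hz⟩
      exact ⟨1, fun _ => t, fun _ => u, fun _ => ht, by simpa using hu, by simpa using hz⟩
    simpa using smul_mem_multiReach hc hy1

theorem smul_multiReach (n m : ℕ) {T : Set ℝ} (hT : T.Nonempty)
    (Γ : ℝ → Matrix (Fin n) (Fin m) ℝ) {r c : ℝ} (hr : 0 ≤ r) (hc : 0 ≤ c) :
    r • multiReach n m Γ c T = multiReach n m Γ (r * c) T := by
  rw [multiReach_eq_smul_convexHull n m hT Γ hc,
    multiReach_eq_smul_convexHull n m hT Γ (mul_nonneg hr hc), smul_smul]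

theorem isCompact_multiReach (n m : ℕ) {T : Set ℝ} (hT : T.Nonempty) (hTc : IsCompact T)
    {Γ : ℝ → Matrix (Fin n) (Fin m) ℝ} (hΓ : Continuous Γ) {c : ℝ} (hc : 0 ≤ c) :
    IsCompact (multiReach n m Γ c T) := by
  rw [multiReach_eq_smul_convexHull n m hT Γ hc]
  exact (isCompact_convexHull_of_finiteDimensional (isCompact_singleReach n m hTc hΓ 1)).smul c

end

/-- Optimality is equivalent to boundary membership: under controllability
(`0 ∈ interior S*(1,T)`), `c > 0` is the minimum cost to reach `ω` iff `ω` lies in the frontier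
of `S*(c,T)`. -/
theorem optimal_iff_frontier (n m : ℕ) (T : Set ℝ) (hT : T.Nonempty) (hTc : IsCompact T)
    (Γ : ℝ → Matrix (Fin n) (Fin m) ℝ) (hΓ : Continuous Γ)
    (hctrl : (0 : EuclideanSpace ℝ (Fin n)) ∈ interior (multiReach n m Γ 1 T))
    (c : ℝ) (hc : 0 < c) (ω : EuclideanSpace ℝ (Fin n)) :
    (ω ∈ multiReach n m Γ c T ∧ ∀ c' : ℝ, 0 ≤ c' → c' < c → ω ∉ multiReach n m Γ c' T) ↔
      ω ∈ frontier (multiReach n m Γ c T) := by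
  have hnhds : multiReach n m Γ c T ∈ nhds (0 : EuclideanSpace ℝ (Fin n)) := by
    simpa only [smul_multiReach n m hT Γ hc.le zero_le_one, mul_one] using
      (set_smul_mem_nhds_zero_iff hc.ne').2 (mem_interior_iff_mem_nhds.1 hctrl)
  rw [← gauge_eq_one_iff_mem_frontier (convex_multiReach n m T Γ c) hnhds]
  constructor
  · rintro ⟨hω, hmin⟩
    refine (gauge_le_one_of_mem hω).antisymm (not_lt.1 fun hlt => ?_)
    obtain ⟨r, hr0, hr1, hr⟩ := exists_lt_of_gauge_lt (absorbent_nhds_zero hnhds) hlt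
    rw [smul_multiReach n m hT Γ hr0.le hc.le] at hr
    exact hmin (r * c) (by positivity) (mul_lt_of_lt_one_left hc hr1) hr
  · intro hω
    refine ⟨(isCompact_multiReach n m hT hTc hΓ hc.le).isClosed.frontier_subset
      ((gauge_eq_one_iff_mem_frontier (convex_multiReach n m T Γ c) hnhds).1 hω), ?_⟩
    intro c' hc' hlt hmem
    have hdiv : 0 ≤ c' / c := by positivity
    rw [← div_mul_cancel₀ c' hc.ne', ← smul_multiReach n m hT Γ hdiv hc.le] at hmem
    exact (gauge_le_of_mem hdiv hmem).not_gt (hω ▸ (div_lt_one hc).2 hlt)
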